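/- Let w ∈ ℝ^d be fixed and nonzero, and let z₁,…,z_n be i.i.d. N(0, σ_z² I_d). Then E[‖Z^T 1_{Zw ≥ 0}‖₂²] = σ_z² (nd/2 + n(n-1)/(2π)), where Z ∈ ℝ^{n×d} has rows zᵢ and 1_{Zw ≥ 0} is the entrywise indicator vector. -/

import Mathlib

open MeasureTheory ProbabilityTheory

lemma halfmean (v : NNReal) (hv : v ≠ 0) :
    ∫ x, (if 0 ≤ x then x else 0) ∂(gaussianReal 0 v) = Real.sqrt v / Real.sqrt (2 * Real.pi) := by
  have hv' : (0:ℝ) < v := by positivity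
  rw [integral_gaussianReal_eq_integral_smul hv]
  have h1 : ∀ x : ℝ, gaussianPDFReal 0 v x • (if 0 ≤ x then x else 0) =
      (Set.Ici (0:ℝ)).indicator (fun x => (Real.sqrt (2 * Real.pi * v))⁻¹ *
        (x ^ (1:ℝ) * Real.exp (-(1/(2*v)) * x ^ (2:ℝ)))) x := by
    intro x
    by_cases hx : 0 ≤ x
    · simp [hx, gaussianPDFReal]
      ring_nf
    · simp [hx]
  simp_rw [h1]
  rw [integral_indicator measurableSet_Ici, integral_Ici_eq_integral_Ioi, integral_const_mul,
    integral_rpow_mul_exp_neg_mul_rpow (by norm_num) (by norm_num) (by positivity)]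
  have h2 : (-(1 + 1) / 2 : ℝ) = -1 := by norm_num
  have h3 : ((1 + 1) / 2 : ℝ) = 1 := by norm_num
  rw [h2, h3, Real.rpow_neg_one, Real.Gamma_one, Real.sqrt_mul (by positivity)]
  have := Real.mul_self_sqrt hv'.le
  field_simp
  rw [sq, this]

variable {d : ℕ}

lemma negInv (v : NNReal) : Measure.IsNegInvariant (gaussianReal 0 v) := by
  constructor
  have := gaussianReal_map_neg (μ := 0) (v := v)
  simpa [Measure.neg] using! this

lemma gl (v : NNReal) : HasGaussianLaw (fun z : Fin d → ℝ => z)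
    (Measure.pi fun _ : Fin d => gaussianReal 0 v) := by
  have h : iIndepFun (fun (i : Fin d) (z : Fin d → ℝ) => z i)
      (Measure.pi fun _ : Fin d => gaussianReal 0 v) :=
    iIndepFun_pi (X := fun _ ↦ id) (fun _ ↦ aemeasurable_id)
  exact h.hasGaussianLaw fun i =>
    (MeasurePreserving.hasLaw (measurePreserving_eval (fun _ : Fin d => gaussianReal 0 v) i)).hasGaussianLaw

lemma covij (v : NNReal) (i j : Fin d) :
    cov[fun z : Fin d → ℝ => z i, fun z => z j; Measure.pi fun _ : Fin d => gaussianReal 0 v]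
      = if i = j then (v : ℝ) else 0 := by
  have h : iIndepFun (fun (i : Fin d) (z : Fin d → ℝ) => z i)
      (Measure.pi fun _ : Fin d => gaussianReal 0 v) :=
    iIndepFun_pi (X := fun _ ↦ id) (fun _ ↦ aemeasurable_id)
  have hm : ∀ i, MemLp (fun z : Fin d → ℝ => z i) 2 (Measure.pi fun _ : Fin d => gaussianReal 0 v) :=
    fun i => (HasGaussianLaw.eval (X := fun i (z : Fin d → ℝ) => z i) (gl v) i).memLp_two
  split_ifs with hij
  · subst hij
    rw [covariance_self (measurable_pi_apply i).aemeasurable]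
    have := (measurePreserving_eval (fun _ : Fin d => gaussianReal 0 v) i).variance_fun_comp
      (f := fun x => x) (by fun_prop)
    rw [variance_fun_id_gaussianReal] at this
    exact this
  · exact (h.indepFun hij).covariance_eq_zero (hm i) (hm j)

lemma meani (v : NNReal) (i : Fin d) :
    ∫ z : Fin d → ℝ, z i ∂(Measure.pi fun _ : Fin d => gaussianReal 0 v) = 0 := by
  have := integral_comp_eval (μ := fun _ : Fin d => gaussianReal 0 v) (i := i) (f := fun x => x)
    (by fun_prop)
  rw [integral_id_gaussianReal] at this
  exact this

lemma memi (v : NNReal) (i : Fin d) :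
    MemLp (fun z : Fin d → ℝ => z i) 2 (Measure.pi fun _ : Fin d => gaussianReal 0 v) :=
  (HasGaussianLaw.eval (X := fun i (z : Fin d → ℝ) => z i) (gl v) i).memLp_two

lemma sqi (v : NNReal) (i : Fin d) :
    ∫ z : Fin d → ℝ, z i ^ 2 ∂(Measure.pi fun _ : Fin d => gaussianReal 0 v) = v := by
  have h := covij v i i
  rw [covariance_eq_sub (memi v i) (memi v i), meani] at h
  simp at h
  rw [← h]
  congr 1; ext z; simp [sq]

lemma lawu (v : NNReal) (w : Fin d → ℝ) :
    (Measure.pi fun _ : Fin d => gaussianReal 0 v).map (fun z => ∑ l, z l * w l) =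
      gaussianReal 0 (v * (∑ l, w l ^ 2).toNNReal) := by
  have hg : HasGaussianLaw (fun z : Fin d → ℝ => ∑ l, z l * w l)
    (Measure.pi fun _ : Fin d => gaussianReal 0 v) := by
    have := (gl (d := d) v).map_fun (∑ l, (w l) • ContinuousLinearMap.proj (R := ℝ) l)
    simpa [mul_comm] using this
  rw [hg.map_eq_gaussianReal]
  congr 1
  · rw [integral_finsetSum _ fun i _ => ((memi v i).integrable (by norm_num)).mul_const _]
    simp [integral_mul_const, meani]
  · rw [← covariance_self hg.aemeasurable,
      covariance_fun_sum_fun_sum (fun i => (memi v i).mul_const _) (fun i => (memi v i).mul_const _)]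
    simp only [covariance_mul_const_left, covariance_mul_const_right, covij]
    have : ∑ x, ∑ x_1, (if x = x_1 then (v : ℝ) else 0) * w x_1 * w x = v * ∑ l, w l ^ 2 := by
      simp [Finset.mul_sum, sq, mul_assoc]
    rw [← Real.toNNReal_coe (r := v), ← Real.toNNReal_mul (by positivity), ← this]
    congr 1
    refine Finset.sum_congr rfl fun x _ => Finset.sum_congr rfl fun y _ => ?_
    simp [Real.toNNReal_coe]
    ring_nf

lemma meanf (v : NNReal) (hv : v ≠ 0) (w : Fin d → ℝ) (hw : 0 < ∑ l, w l ^ 2) (j : Fin d) :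
    ∫ z : Fin d → ℝ, (if 0 ≤ ∑ l, z l * w l then z j else 0)
      ∂(Measure.pi fun _ : Fin d => gaussianReal 0 v) =
      w j / (∑ l, w l ^ 2) * (Real.sqrt (v * ∑ l, w l ^ 2) / Real.sqrt (2 * Real.pi)) := by
  set S := ∑ l, w l ^ 2 with hS
  set γ := (Measure.pi fun _ : Fin d => gaussianReal 0 v) with hγ
  set u : (Fin d → ℝ) → ℝ := fun z => ∑ l, z l * w l with hu
  have hum : Measurable u := by fun_prop
  set c := w j / S with hc
  have hu2 : MemLp u 2 γ := memLp_finsetSum _ fun i _ => (memi v i).mul_const _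
  have hind : IndepFun u (fun z : Fin d → ℝ => z j - c * u z) γ := by
    apply HasGaussianLaw.indepFun_of_covariance_eq_zero
    · have := (gl (d := d) v).map_fun
        ((∑ l, (w l) • ContinuousLinearMap.proj (R := ℝ) (φ := fun _ : Fin d => ℝ) l).prod
        (ContinuousLinearMap.proj (R := ℝ) (φ := fun _ : Fin d => ℝ) j -
          c • (∑ l, (w l) • ContinuousLinearMap.proj (R := ℝ) (φ := fun _ : Fin d => ℝ) l)))
      simpa [mul_comm, hu] using this
    · rw [covariance_fun_sub_right hu2 (memi v j) (hu2.const_mul c), covariance_const_mul_right]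
      have h1 : cov[u, fun z => z j; γ] = v * w j := by
        rw [hu, covariance_fun_sum_left (fun i => (memi v i).mul_const _) (memi v j)]
        simp [covariance_mul_const_left, hγ, covij]
      have h2 : cov[u, u; γ] = v * S := by
        rw [covariance_self hum.aemeasurable, ← variance_id_map hum.aemeasurable, lawu,
          variance_id_gaussianReal]
        rw [NNReal.coe_mul, ← hS, Real.coe_toNNReal _ hw.le]
      rw [h1, h2, hc]; field_simp; ring
  have hind2 : IndepFun (fun z => if 0 ≤ u z then (1:ℝ) else 0)
      (fun z : Fin d → ℝ => z j - c * u z) γ :=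
    hind.comp (φ := fun x : ℝ => if 0 ≤ x then (1:ℝ) else 0) (ψ := id)
      (Measurable.ite measurableSet_Ici (by fun_prop) (by fun_prop)) measurable_id
  have hmi : Measurable (fun z => if 0 ≤ u z then (1:ℝ) else 0) :=
    Measurable.ite (hum measurableSet_Ici) (by fun_prop) (by fun_prop)
  have hb : ∀ z, ‖(if 0 ≤ u z then (1:ℝ) else 0)‖ ≤ 1 := by
    intro z; split_ifs <;> simp
  have hzi : Integrable (fun z : Fin d → ℝ => z j) γ := (memi v j).integrable (by norm_num)
  have hui : Integrable u γ := hu2.integrable (by norm_num)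
  have hz0 := hind2.integral_fun_mul_eq_mul_integral hmi.aestronglyMeasurable (by fun_prop)
  have hu0 : ∫ z, u z ∂γ = 0 := by
    rw [← integral_map (f := fun x => x) hum.aemeasurable (by fun_prop), lawu, integral_id_gaussianReal]
  rw [integral_sub hzi (hui.const_mul c), integral_const_mul, hu0, meani] at hz0
  have e : ∀ z, (if 0 ≤ u z then z j else 0) = (if 0 ≤ u z then (1:ℝ) else 0) * (z j - c * u z)
      + c * (if 0 ≤ u z then u z else 0) := by
    intro z; split_ifs <;> ring
  change ∫ z, (if 0 ≤ u z then z j else 0) ∂γ = _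
  simp_rw [e]
  have hm := integral_map (μ := γ) (f := fun x : ℝ => if 0 ≤ x then x else 0) hum.aemeasurable
    (Measurable.ite measurableSet_Ici (by fun_prop) (by fun_prop)).aestronglyMeasurable
  rw [lawu, halfmean _ (by simp [hv, ← hS, hw])] at hm
  rw [integral_add, hz0, integral_const_mul, ← hm]
  · simp [hw.le, ← hS]
  · exact (hzi.sub (hui.const_mul c)).bdd_mul hmi.aestronglyMeasurable (ae_of_all _ hb)
  · refine Integrable.const_mul ?_ _
    refine (hui.bdd_mul hmi.aestronglyMeasurable (ae_of_all _ hb)).congr (ae_of_all _ fun z => ?_)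
    simp

lemma memf (v : NNReal) (w : Fin d → ℝ) (j : Fin d) :
    MemLp (fun z : Fin d → ℝ => (if 0 ≤ ∑ l, z l * w l then z j else 0)) 2
      (Measure.pi fun _ : Fin d => gaussianReal 0 v) := by
  refine (memi v j).mono ?_ (ae_of_all _ fun z => ?_)
  · have hum : Measurable (fun z : Fin d → ℝ => ∑ l, z l * w l) := by fun_prop
    exact (Measurable.ite (hum measurableSet_Ici) (by fun_prop) (by fun_prop)).aestronglyMeasurable
  · split_ifs <;> simp

lemma sqf (v : NNReal) (hv : v ≠ 0) (w : Fin d → ℝ) (hw : 0 < ∑ l, w l ^ 2) (j : Fin d) :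
    ∫ z : Fin d → ℝ, (if 0 ≤ ∑ l, z l * w l then z j else 0) ^ 2
      ∂(Measure.pi fun _ : Fin d => gaussianReal 0 v) = v / 2 := by
  have := negInv v
  set γ := (Measure.pi fun _ : Fin d => gaussianReal 0 v) with hγ
  have hneg : Measure.IsNegInvariant γ := by rw [hγ]; infer_instance
  have hum : Measurable (fun z : Fin d → ℝ => ∑ l, z l * w l) := by fun_prop
  have hi := (memf v w j).integrable_sq
  have h1 := integral_neg_eq_self (fun z : Fin d → ℝ => (if 0 ≤ ∑ l, z l * w l then z j else 0) ^ 2) γ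
  have hi' := hi.comp_neg
  have hnull : ∀ᵐ z ∂γ, ∑ l, z l * w l ≠ 0 := by
    have h : γ ((fun z : Fin d → ℝ => ∑ l, z l * w l) ⁻¹' {0}) = 0 := by
      rw [← Measure.map_apply hum (measurableSet_singleton _), lawu]
      have := nullSingletonClass_gaussianReal (μ := 0) (v := v * (∑ l, w l ^ 2).toNNReal)
        (by simp [hv, hw])
      exact measure_singleton _
    rw [ae_iff]; simpa using! h
  have h2 : ∫ z : Fin d → ℝ, ((if 0 ≤ ∑ l, z l * w l then z j else 0) ^ 2 +
     (if 0 ≤ ∑ l, (-z) l * w l then (-z) j else 0) ^ 2) ∂γ = v := by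
    rw [← sqi v j]
    apply integral_congr_ae
    filter_upwards [hnull] with z hz
    simp only [Pi.neg_apply, neg_mul, Finset.sum_neg_distrib, Left.nonneg_neg_iff]
    rcases lt_or_gt_of_ne hz with h | h
    · simp [h.le, h.not_ge]
    · simp [h.le, h.not_ge]
  rw [integral_add hi hi', h1] at h2
  linarith

/-- For fixed w ≠ 0 and z₁,…,z_n i.i.d. N(0, σ_z² I_d),
E ‖Zᵀ 1_{Zw ≥ 0}‖₂² = σ_z² (nd/2 + n(n-1)/(2π)). -/
theorem stmt12 {n d : ℕ} (σz : NNReal) (w : Fin d → ℝ) (hw : w ≠ 0) :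
    ∫ Z : Fin n → Fin d → ℝ,
        (∑ j, (∑ i, (if 0 ≤ ∑ l, Z i l * w l then Z i j else 0)) ^ 2)
        ∂(Measure.pi fun _ : Fin n => Measure.pi fun _ : Fin d =>
          gaussianReal 0 (σz ^ 2)) =
      (σz : ℝ) ^ 2 * ((n * d) / 2 + (n * ((n : ℝ) - 1)) / (2 * Real.pi)) := by
  have hS : 0 < ∑ l, w l ^ 2 := by
    obtain ⟨i, hi⟩ := Function.ne_iff.1 hw
    exact Finset.sum_pos' (fun i _ => sq_nonneg _) ⟨i, Finset.mem_univ _, by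
      have : w i ≠ 0 := hi
      positivity⟩
  by_cases hσ : σz = 0
  · subst hσ
    have h0 : ∀ᵐ x ∂(gaussianReal 0 ((0:NNReal) ^ 2)), x = 0 := by
      simp [gaussianReal_zero_var]
    have h1 : ∀ᵐ Z ∂(Measure.pi fun _ : Fin n => Measure.pi fun _ : Fin d =>
        gaussianReal 0 ((0:NNReal) ^ 2)), ∀ i j, Z i j = 0 := by
      rw [ae_all_iff]; intro i
      rw [ae_all_iff]; intro j
      have a := (measurePreserving_eval (fun _ : Fin d =>
        gaussianReal 0 ((0:NNReal) ^ 2)) j).quasiMeasurePreserving.ae h0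
      exact (measurePreserving_eval (fun _ : Fin n => Measure.pi fun _ : Fin d =>
        gaussianReal 0 ((0:NNReal) ^ 2)) i).quasiMeasurePreserving.ae a
    rw [integral_eq_zero_of_ae]
    · simp
    · filter_upwards [h1] with Z hZ
      simp [hZ]
  set v := σz ^ 2 with hvd
  have hv : v ≠ 0 := by simp [hvd, hσ]
  set γ := (Measure.pi fun _ : Fin d => gaussianReal 0 v) with hγ
  set f : Fin d → (Fin d → ℝ) → ℝ := fun j z => if 0 ≤ ∑ l, z l * w l then z j else 0 with hf
  have hmp : ∀ i, MeasurePreserving (fun Z : Fin n → Fin d → ℝ => Z i) (Measure.pi fun _ => γ) γ :=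
    fun i => measurePreserving_eval (fun _ : Fin n => γ) i
  have hm : ∀ j i, MemLp (fun Z : Fin n → Fin d → ℝ => f j (Z i)) 2 (Measure.pi fun _ => γ) :=
    fun j i => (memf v w j).comp_measurePreserving (hmp i)
  have hms : ∀ j, MemLp (fun Z : Fin n → Fin d → ℝ => ∑ i, f j (Z i)) 2 (Measure.pi fun _ => γ) :=
    fun j => memLp_finsetSum _ fun i _ => hm j i
  change ∫ Z : Fin n → Fin d → ℝ, (∑ j, (∑ i, f j (Z i)) ^ 2) ∂(Measure.pi fun _ => γ) = _
  rw [integral_finsetSum _ fun j _ => (hms j).integrable_sq]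
  have key : ∀ j, ∫ Z : Fin n → Fin d → ℝ, (∑ i, f j (Z i)) ^ 2 ∂(Measure.pi fun _ => γ) =
      n * (v / 2) + n * (n - 1) * (w j ^ 2 * (v / (2 * Real.pi) / ∑ l, w l ^ 2)) := by
    intro j
    have hE : ∫ z, f j z ∂γ = _ := meanf v hv w hS j
    have hE2 : ∫ z, f j z ^ 2 ∂γ = _ := sqf v hv w hS j
    have hsq : (∫ z, f j z ∂γ) ^ 2 = w j ^ 2 * (v / (2 * Real.pi) / ∑ l, w l ^ 2) := by
      rw [hE, mul_pow, div_pow, div_pow, Real.sq_sqrt (by positivity), Real.sq_sqrt (by positivity)]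
      field_simp
    have hV := variance_sum_pi (μ := fun _ : Fin n => γ) (X := fun _ => f j) (fun _ => memf v w j)
    have hs : (∑ i, fun Z : Fin n → Fin d → ℝ => f j (Z i)) = fun Z => ∑ i, f j (Z i) := by
      ext; simp
    have hI : ∫ Z : Fin n → Fin d → ℝ, (∑ i, f j (Z i)) ∂(Measure.pi fun _ => γ)
        = n * ∫ z, f j z ∂γ := by
      rw [integral_finsetSum _ fun i _ => (hm j i).integrable (by norm_num)]
      have : ∀ i : Fin n, ∫ Z : Fin n → Fin d → ℝ, f j (Z i) ∂(Measure.pi fun _ => γ)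
         = ∫ z, f j z ∂γ := fun i =>
        integral_comp_eval (μ := fun _ : Fin n => γ) (memf v w j).aestronglyMeasurable
      simp [this]
    have hfv := variance_eq_sub (memf v w j)
    rw [hs, variance_eq_sub (hms j)] at hV
    simp only [Pi.pow_apply, Finset.sum_const, Finset.card_univ, Fintype.card_fin, nsmul_eq_mul] at hV hfv
    change Var[f j; γ] = (∫ z, f j z ^ 2 ∂γ) - (∫ z, f j z ∂γ) ^ 2 at hfv
    rw [hfv, hI, mul_pow, hsq, hE2] at hV
    linarith
  simp_rw [key]
  rw [Finset.sum_add_distrib, ← Finset.mul_sum, ← Finset.mul_sum, ← Finset.sum_mul]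
  simp [hvd]
  field_simp
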